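/- Let k ≥ 2 be a natural number and let G be a graph of average degree at least 8k that contains an even cycle, with even girth g (the length of a shortest even cycle). Then G contains cycles of (g/2 − 1)·k consecutive even lengths; that is, there is an even integer t such that for every i with 0 ≤ i < (g/2 − 1)·k, G contains a cycle of length t + 2i. -/

import Mathlib

theorem Function.Periodic.eq_of_eqOn_interval {α : Type*} {x y : ℤ → α} {p : ℤ} (lo : ℤ)
    (hp : 0 < p) (hx : Function.Periodic x p) (hy : Function.Periodic y p)
    (h : ∀ s, lo ≤ s → s < lo + p → x s = y s) (s : ℤ) : x s = y s := by
  have h1 := h (lo + (s - lo) % p) (by have := Int.emod_nonneg (s - lo) hp.ne'; omega)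
    (by have := Int.emod_lt_of_pos (s - lo) hp; omega)
  have e : s = lo + (s - lo) % p + (s - lo) / p * p := by
    have := Int.emod_add_mul_ediv (s - lo) p
    linarith
  have h2 := hx.int_mul ((s - lo) / p) (lo + (s - lo) % p)
  have h3 := hy.int_mul ((s - lo) / p) (lo + (s - lo) % p)
  rw [e]
  simp only [Int.cast_id] at h2 h3
  rw [h2, h3, h1]

/-- The sequence of indices `g 0, …, g L` is a path in the graph consisting of the cycle
`lo, lo + 1, …, lo + n - 1` together with the chord from `0` to `r`. -/
structure IsChordedPath (n r : ℤ) (L : ℕ) (g : ℕ → ℤ) : Prop where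
  window : ∃ lo, ∀ a ≤ L, lo ≤ g a ∧ g a < lo + n
  inj : ∀ a ≤ L, ∀ b ≤ L, g a = g b → a = b
  step : ∀ a < L, g (a + 1) = g a + 1 ∨ g (a + 1) = g a - 1 ∨ (g a = 0 ∧ g (a + 1) = r)

theorem const_of_forall_chordedPath {α : Type*} {x : ℤ → α} {m ρ : ℤ} {j : ℕ}
    (hj : 1 ≤ j) (hjm : (j : ℤ) < m) (hρ : 1 ≤ ρ) (hρm : ρ ≤ m - 2)
    (hm : Function.Periodic x m)
    (H : ∀ g, IsChordedPath (2 * m) (2 * ρ + 1) (2 * j) g →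
      ∀ a b, g 0 = 2 * a → g (2 * j) = 2 * b → x a = x b) (a b : ℤ) : x a = x b := by
  have hper : Function.Periodic x (j : ℤ) := by
    intro i
    refine (H (fun t ↦ 2 * i + t) ⟨⟨2 * i, ?_⟩, ?_, ?_⟩ i (i + j) ?_ ?_).symm <;>
      intros <;> grind
  have R1 : (j : ℤ) ≤ m - ρ - 1 → ∀ s : ℤ, 0 ≤ s → s < j → x (-s) = x (ρ - s) := by
    intro hc s hs hsj
    rw [← hper (ρ - s)]
    refine H (fun t ↦ if (t : ℤ) ≤ 2 * s then t - 2 * s else 2 * ρ + 1 + (t - 2 * s - 1))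
      ⟨⟨- (2 * s), ?_⟩, ?_, ?_⟩ _ _ ?_ ?_ <;> intros <;> grind
  have R2 : ∀ s : ℤ, 0 ≤ s → s < j → j - ρ ≤ s → s ≤ m - ρ - 1 → x (-s) = x (ρ + 1 + s) := by
    intro s hs hsj h1 h2
    rw [show ρ + 1 + s = (ρ + 1 - j + s) + j by ring, hper]
    refine H (fun t ↦ if (t : ℤ) ≤ 2 * s then t - 2 * s else 2 * ρ + 1 - (t - 2 * s - 1))
      ⟨⟨- (2 * s), ?_⟩, ?_, ?_⟩ _ _ ?_ ?_ <;> intros <;> grind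
  have R3 : ∀ s : ℤ, 0 ≤ s → s < j → s ≤ ρ → j - m + ρ + 1 ≤ s → x s = x (ρ - s) := by
    intro s hs hsj h1 h2
    rw [← hper (ρ - s)]
    refine H (fun t ↦ if (t : ℤ) ≤ 2 * s then 2 * s - t else 2 * ρ + 1 + (t - 2 * s - 1))
      ⟨⟨0, ?_⟩, ?_, ?_⟩ _ _ ?_ ?_ <;> intros <;> grind
  have R4 : (j : ℤ) ≤ ρ → ∀ s : ℤ, 0 ≤ s → s < j → x s = x (ρ + 1 + s) := by
    intro hc s hs hsj
    rw [show ρ + 1 + s = (ρ + 1 - j + s) + j by ring, hper]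
    refine H (fun t ↦ if (t : ℤ) ≤ 2 * s then 2 * s - t else 2 * ρ + 1 - (t - 2 * s - 1))
      ⟨⟨0, ?_⟩, ?_, ?_⟩ _ _ ?_ ?_ <;> intros <;> grind
  have neg : ∀ {p : ℤ}, Function.Periodic x p → ∀ c, Function.Periodic (fun s ↦ x (c - s)) p := by
    intro p hp c s
    change x (c - (s + p)) = x (c - s)
    rw [← hp (c - (s + p))]
    congr 1
    ring
  have pos : ∀ {p : ℤ}, Function.Periodic x p → ∀ c, Function.Periodic (fun s ↦ x (c + s)) p := by
    intro p hp c s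
    change x (c + (s + p)) = x (c + s)
    rw [← add_assoc, hp]
  have perρ : (j : ℤ) ≤ m - ρ - 1 → Function.Periodic x ρ := by
    intro hc s
    have := Function.Periodic.eq_of_eqOn_interval (x := fun s ↦ x (0 - s))
      (y := fun s ↦ x (ρ - s)) 0 (by omega) (neg hper 0) (neg hper ρ)
      (fun s h1 h2 ↦ by simpa using R1 hc s h1 (by simpa using h2)) (-s)
    simp only [sub_neg_eq_add, zero_add] at this
    rw [this, add_comm]
  have perρ1 : (j : ℤ) ≤ ρ → Function.Periodic x (ρ + 1) := by
    intro hc s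
    have := Function.Periodic.eq_of_eqOn_interval (x := x)
      (y := fun s ↦ x (ρ + 1 + s)) 0 (by omega) hper (pos hper (ρ + 1))
      (fun s h1 h2 ↦ R4 hc s h1 (by simpa using h2)) s
    rw [this, add_comm]
  have key : ∀ p lo₂ lo₃ : ℤ, 0 < p → Function.Periodic x p →
      (∀ s, lo₂ ≤ s → s < lo₂ + p → 0 ≤ s ∧ s < j ∧ j - ρ ≤ s ∧ s ≤ m - ρ - 1) →
      (∀ s, lo₃ ≤ s → s < lo₃ + p → 0 ≤ s ∧ s < j ∧ s ≤ ρ ∧ j - m + ρ + 1 ≤ s) →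
      Function.Periodic x 1 := by
    intro p lo₂ lo₃ hp hx h₂ h₃ s
    have e₂ := Function.Periodic.eq_of_eqOn_interval (x := fun s ↦ x (0 - s))
      (y := fun s ↦ x (ρ + 1 + s)) lo₂ hp (neg hx 0) (pos hx _)
      (fun s h1 h2 ↦ by
        obtain ⟨a, b, c, d⟩ := h₂ s h1 h2
        simpa using R2 s a b c d) (s - ρ)
    have e₃ := Function.Periodic.eq_of_eqOn_interval (x := x)
      (y := fun s ↦ x (ρ - s)) lo₃ hp hx (neg hx _)
      (fun s h1 h2 ↦ by
        obtain ⟨a, b, c, d⟩ := h₃ s h1 h2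
        exact R3 s a b c d) s
    rw [e₃, show ρ - s = 0 - (s - ρ) by ring, e₂]
    congr 1
    ring
  have per1 : Function.Periodic x 1 := by
    by_cases h1 : (j : ℤ) ≤ m - ρ - 1 <;> by_cases h2 : (j : ℤ) ≤ ρ
    · have := (perρ1 h2).sub_period (perρ h1)
      simpa using this
    · exact key ρ (j - ρ) 0 (by omega) (perρ h1) (by intros; omega) (by intros; omega)
    · refine key (m - (ρ + 1)) 0 (j - m + ρ + 1) (by omega) (hm.sub_period (perρ1 h2)) ?_ ?_ <;>
        (intros; omega)
    · refine key (m - j) (j - ρ) (j - m + ρ + 1) (by omega) (hm.sub_period hper) ?_ ?_ <;>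
        (intros; omega)
  have h0 : ∀ s : ℤ, x s = x 0 := by
    intro s
    simpa using per1.int_mul s 0
  rw [h0 a, h0 b]

theorem SimpleGraph.exists_isPath_of_injOn {V : Type*} (G : SimpleGraph V) (L : ℕ) (f : ℕ → V)
    (hinj : Set.InjOn f (Set.Iic L)) (hadj : ∀ a < L, G.Adj (f a) (f (a + 1))) :
    ∃ p : G.Walk (f 0) (f L), p.IsPath ∧ p.length = L ∧
      ∀ v ∈ p.support, ∃ a ≤ L, f a = v := by
  induction L with
  | zero => exact ⟨.nil, by simp, by simp, by simp⟩
  | succ L ih =>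
    obtain ⟨p, hp, hl, hs⟩ := ih (hinj.mono fun a ha ↦ by simp at *; omega)
      fun a ha ↦ hadj a (by omega)
    refine ⟨p.concat (hadj L (by omega)), hp.concat ?_ _, by simp [hl], ?_⟩
    · intro h
      obtain ⟨a, ha, e⟩ := hs _ h
      have := hinj (by simp; omega) (by simp) e
      omega
    · intro v hv
      rw [SimpleGraph.Walk.support_concat] at hv
      simp only [List.mem_append, List.mem_singleton] at hv
      rcases hv with hv | rfl
      · obtain ⟨a, ha, e⟩ := hs v hv
        exact ⟨a, by omega, e⟩
      · exact ⟨L + 1, le_rfl, rfl⟩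

theorem SimpleGraph.exists_isCycle_of_injOn {V : Type*} (G : SimpleGraph V) (L : ℕ) (f : ℕ → V)
    (hL : 2 ≤ L) (hinj : Set.InjOn f (Set.Iic L)) (hadj : ∀ a < L, G.Adj (f a) (f (a + 1)))
    (hclose : G.Adj (f L) (f 0)) :
    ∃ (v : V) (c : G.Walk v v), c.IsCycle ∧ c.length = L + 1 := by
  obtain ⟨p, hp, hl, -⟩ := G.exists_isPath_of_injOn L f hinj hadj
  refine ⟨_, .cons hclose p, (SimpleGraph.Walk.cons_isCycle_iff _ _).2 ⟨hp, fun h ↦ ?_⟩,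
    by simp [hl]⟩
  have := hp.length_eq_one_of_mem_edges (Sym2.eq_swap ▸ h)
  omega

open Finset Classical in
/-- Some cut contains at least half of the edges; here cut edges are counted in both directions. -/
theorem SimpleGraph.exists_cut {V : Type*} [Fintype V] (G : SimpleGraph V) :
    ∃ χ : V → Bool, G.edgeSet.ncard ≤ #{e : V × V | G.Adj e.1 e.2 ∧ χ e.1 ≠ χ e.2} := by
  by_contra! h
  have h1 : ∀ χ : V → Bool, 2 * #{e : V × V | G.Adj e.1 e.2 ∧ χ e.1 ≠ χ e.2} <
      #{e : V × V | G.Adj e.1 e.2} := by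
    intro χ
    have := h χ
    have e := G.two_mul_card_edgeFinset
    rw [Set.ncard_eq_toFinset_card'] at this
    change 2 * #G.edgeFinset = #(univ.filter fun e : V × V ↦ G.Adj e.1 e.2) at e
    rw [← e]
    exact Nat.mul_lt_mul_of_pos_left this two_pos
  have h2 : ∀ u v : V, u ≠ v → #{χ : V → Bool | χ u = χ v} = #{χ : V → Bool | χ u ≠ χ v} := by
    intro u v huv
    refine card_bij (fun χ _ ↦ Function.update χ u (!χ u)) ?_ ?_ ?_
    · intro χ hχ
      simp only [mem_filter, mem_univ, true_and] at hχ ⊢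
      simp [Function.update_of_ne huv.symm, ← hχ]
    · intro χ _ ψ _ e
      have e1 : ∀ w, χ w = ψ w := by
        intro w
        by_cases hw : w = u
        · subst hw
          simpa using congrFun e w
        · simpa [Function.update_of_ne hw] using congrFun e w
      exact funext e1
    · intro ψ hψ
      simp only [mem_filter, mem_univ, true_and] at hψ
      refine ⟨Function.update ψ u (!ψ u), ?_, ?_⟩
      · simp only [mem_filter, mem_univ, true_and]
        simp only [Function.update_self, Function.update_of_ne huv.symm]
        revert hψ
        cases ψ u <;> cases ψ v <;> simp
      · simp
  have h3 : ∀ u v : V, u ≠ v → 2 * #{χ : V → Bool | χ u ≠ χ v} = #(univ : Finset (V → Bool)) := by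
    intro u v huv
    have := card_filter_add_card_filter_not (s := (univ : Finset (V → Bool))) (fun χ ↦ χ u = χ v)
    rw [h2 u v huv] at this
    simp only [ne_eq] at *
    omega
  have h4 : ∑ χ : V → Bool, 2 * #{e : V × V | G.Adj e.1 e.2 ∧ χ e.1 ≠ χ e.2} =
      ∑ _χ : V → Bool, #{e : V × V | G.Adj e.1 e.2} := by
    rw [← mul_sum]
    have := sum_card_bipartiteAbove_eq_sum_card_bipartiteBelow
      (s := (univ : Finset (V → Bool))) (t := univ.filter fun e : V × V ↦ G.Adj e.1 e.2)
      (fun χ e ↦ χ e.1 ≠ χ e.2)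
    simp only [bipartiteAbove, bipartiteBelow, filter_filter] at this
    rw [this, mul_sum, sum_const, smul_eq_mul, mul_comm, ← smul_eq_mul, ← sum_const]
    refine sum_congr rfl fun e he ↦ ?_
    exact h3 _ _ (G.ne_of_adj (by simpa using he))
  exact absurd h4 (sum_lt_sum_of_nonempty univ_nonempty fun χ _ ↦ h1 χ).ne

/-- A breadth-first layering of `G`: `d` is the level of a vertex, `p` its parent and `root` the
root of its component; adjacent vertices lie in consecutive levels. -/
structure SimpleGraph.IsLayering {V : Type*} (G : SimpleGraph V) (d : V → ℕ) (p root : V → V) :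
    Prop where
  level : ∀ {u v}, G.Adj u v → d u = d v + 1 ∨ d v = d u + 1
  root_eq : ∀ {u v}, G.Adj u v → root u = root v
  eq_root : ∀ {v}, d v = 0 → v = root v
  parent : ∀ {v}, d v ≠ 0 → G.Adj v (p v) ∧ d (p v) + 1 = d v

theorem SimpleGraph.exists_isLayering {V : Type*} (G : SimpleGraph V) (χ : V → Bool)
    (hχ : ∀ u v, G.Adj u v → χ u ≠ χ v) : ∃ d p root, G.IsLayering d p root := by
  classical
  set root : V → V := fun v ↦ (G.connectedComponentMk v).out with hroot
  have hreach : ∀ v, G.Reachable (root v) v := fun v ↦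
    SimpleGraph.ConnectedComponent.exact (Quot.out_eq _)
  have hre : ∀ {u v}, G.Adj u v → root u = root v := fun h ↦ by
    simp only [hroot, SimpleGraph.ConnectedComponent.sound h.reachable]
  let C : G.Coloring Bool := SimpleGraph.Coloring.mk χ fun {u v} h ↦ hχ u v h
  have hpar : ∀ v, Even (G.dist (root v) v) ↔ (χ (root v) = true ↔ χ v = true) := by
    intro v
    obtain ⟨w, hw⟩ := (hreach v).exists_walk_length_eq_dist
    rw [← hw]
    exact C.even_length_iff_congr w
  have hlev : ∀ {u v}, G.Adj u v → G.dist (root u) u = G.dist (root v) v + 1 ∨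
      G.dist (root v) v = G.dist (root u) u + 1 := by
    intro u v h
    have h1 := h.diff_dist_adj (u := root u)
    have h2 := hpar u
    have h3 := hpar v
    rw [← hre h] at h3 ⊢
    have h4 := hχ u v h
    have h5 : G.dist (root u) v ≠ G.dist (root u) u := by
      intro e
      rw [e, h2] at h3
      revert h3 h4
      cases χ u <;> cases χ v <;> simp
    omega
  have hpt : ∀ v, ∃ q, G.dist (root v) v ≠ 0 →
      G.Adj v q ∧ G.dist (root q) q + 1 = G.dist (root v) v := by
    intro v
    by_cases h0 : G.dist (root v) v = 0
    · exact ⟨v, fun h ↦ absurd h0 h⟩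
    have hstep : ∀ {r : V} (w : G.Walk v r), w.length ≠ 0 →
        ∃ q, G.Adj v q ∧ ∃ w' : G.Walk q r, w'.length + 1 = w.length := by
      intro r w hw
      cases w with
      | nil => simp at hw
      | @cons _ q _ h w => exact ⟨q, h, w, by simp⟩
    obtain ⟨w, hw⟩ := (hreach v).symm.exists_walk_length_eq_dist
    rw [SimpleGraph.dist_comm] at hw
    obtain ⟨q, h, w', hw'⟩ := hstep w (hw ▸ h0)
    refine ⟨q, fun _ ↦ ⟨h, ?_⟩⟩
    have h1 := SimpleGraph.dist_le w'
    rw [SimpleGraph.dist_comm] at h1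
    have h2 := hlev h
    rw [← hre h] at h2 ⊢
    omega
  choose p hp using hpt
  refine ⟨fun v ↦ G.dist (root v) v, p, root, hlev, hre, ?_, fun h ↦ hp _ h⟩
  intro v h
  exact ((hreach v).dist_eq_zero_iff.1 h).symm

open Finset Classical in
theorem SimpleGraph.exists_dense_levels {V : Type*} [Fintype V] [Nonempty V] (G : SimpleGraph V)
    (d : V → ℕ) (hd : ∀ {u v}, G.Adj u v → d u = d v + 1 ∨ d v = d u + 1) (k : ℕ)
    (h : 4 * k * Fintype.card V ≤ #{e : V × V | G.Adj e.1 e.2}) :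
    ∃ (i : ℕ) (S : Finset V), S.Nonempty ∧ (∀ v ∈ S, d v = i ∨ d v = i + 1) ∧
      2 * k * #S ≤ #{e ∈ S ×ˢ S | G.Adj e.1 e.2} := by
  set S : ℕ → Finset V := fun i ↦ {v | d v = i ∨ d v = i + 1} with hS
  by_contra! hcon
  have h1 : ∀ i, (S i).Nonempty → #{e ∈ S i ×ˢ S i | G.Adj e.1 e.2} < 2 * k * #(S i) :=
    fun i hi ↦ hcon i (S i) hi (by simp [hS])
  have h2 : ∀ i, #{e ∈ S i ×ˢ S i | G.Adj e.1 e.2} ≤ 2 * k * #(S i) := by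
    intro i
    rcases (S i).eq_empty_or_nonempty with h0 | h0
    · simp [h0]
    · exact (h1 i h0).le
  obtain ⟨N, hN⟩ : ∃ N, ∀ v, d v < N := by
    obtain ⟨M, hM⟩ := (Set.finite_range d).bddAbove
    exact ⟨M + 1, fun v ↦ Nat.lt_succ_of_le (hM ⟨v, rfl⟩)⟩
  have h3 : #{e : V × V | G.Adj e.1 e.2} ≤
      ∑ i ∈ range N, #{e ∈ S i ×ˢ S i | G.Adj e.1 e.2} := by
    refine (card_le_card ?_).trans card_biUnion_le
    intro e he
    simp only [mem_filter, mem_univ, true_and, mem_biUnion, mem_range, mem_product, hS] at he ⊢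
    refine ⟨min (d e.1) (d e.2), (min_le_left _ _).trans_lt (hN _), ?_, he⟩
    have := hd he
    omega
  have h4 : ∑ i ∈ range N, #{e ∈ S i ×ˢ S i | G.Adj e.1 e.2} < ∑ i ∈ range N, 2 * k * #(S i) := by
    obtain ⟨v⟩ := ‹Nonempty V›
    exact sum_lt_sum (fun i _ ↦ h2 i)
      ⟨d v, mem_range.2 (hN v), h1 _ ⟨v, by simp [hS]⟩⟩
  have h5 : ∑ i ∈ range N, #(S i) ≤ 2 * Fintype.card V := by
    have e1 : ∀ i, #(S i) ≤ #{v | d v = i} + #{v | d v = i + 1} := fun i ↦ by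
      simp only [hS, filter_or]
      exact card_union_le _ _
    refine (sum_le_sum fun i _ ↦ e1 i).trans ?_
    rw [sum_add_distrib, two_mul]
    refine add_le_add ?_ ?_
    · rw [← card_biUnion]
      · exact card_le_univ _
      · intro i _ j _ hij
        refine Finset.disjoint_left.2 fun v h1 h2 ↦ hij ?_
        simp only [mem_filter, mem_univ, true_and] at h1 h2
        omega
    · rw [← card_biUnion]
      · exact card_le_univ _
      · intro i _ j _ hij
        refine Finset.disjoint_left.2 fun v h1 h2 ↦ hij ?_
        simp only [mem_filter, mem_univ, true_and] at h1 h2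
        omega
  rw [← mul_sum] at h4
  have h6 : 2 * k * ∑ i ∈ range N, #(S i) ≤ 2 * k * (2 * Fintype.card V) :=
    Nat.mul_le_mul_left _ h5
  nlinarith

open Finset Classical in
theorem SimpleGraph.exists_lt_degree_of_dense {V : Type*} (G : SimpleGraph V) (k : ℕ)
    (hk : 1 ≤ k) (S : Finset V) (hS : S.Nonempty)
    (h : 2 * k * #S ≤ #{e ∈ S ×ˢ S | G.Adj e.1 e.2}) :
    ∃ W ⊆ S, W.Nonempty ∧ ∀ w ∈ W, k < #{u ∈ W | G.Adj w u} := by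
  induction hn : #S using Nat.strong_induction_on generalizing S with
  | _ n ih =>
  by_cases hdeg : ∀ w ∈ S, k < #{u ∈ S | G.Adj w u}
  · exact ⟨S, subset_rfl, hS, hdeg⟩
  push Not at hdeg
  obtain ⟨w, hw, hle⟩ := hdeg
  have hcov : #{e ∈ S ×ˢ S | G.Adj e.1 e.2} ≤
      #{e ∈ S.erase w ×ˢ S.erase w | G.Adj e.1 e.2} + 2 * k := by
    have hsub : {e ∈ S ×ˢ S | G.Adj e.1 e.2} ⊆
        {e ∈ S.erase w ×ˢ S.erase w | G.Adj e.1 e.2} ∪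
          (({u ∈ S | G.Adj w u}.image fun u ↦ (w, u)) ∪
            ({u ∈ S | G.Adj w u}.image fun u ↦ (u, w))) := by
      rintro ⟨a, b⟩ hab
      simp only [mem_filter, mem_product, mem_union, mem_image, mem_erase, Prod.mk.injEq] at hab ⊢
      by_cases ha : a = w
      · subst ha
        exact Or.inr (Or.inl ⟨b, ⟨hab.1.2, hab.2⟩, rfl, rfl⟩)
      by_cases hb : b = w
      · subst hb
        exact Or.inr (Or.inr ⟨a, ⟨hab.1.1, hab.2.symm⟩, rfl, rfl⟩)
      exact Or.inl ⟨⟨⟨ha, hab.1.1⟩, hb, hab.1.2⟩, hab.2⟩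
    have e1 := (card_le_card hsub).trans (card_union_le _ _)
    have e2 := card_union_le ({u ∈ S | G.Adj w u}.image fun u ↦ (w, u))
      ({u ∈ S | G.Adj w u}.image fun u ↦ (u, w))
    have e3 := card_image_le (s := {u ∈ S | G.Adj w u}) (f := fun u ↦ (w, u))
    have e4 := card_image_le (s := {u ∈ S | G.Adj w u}) (f := fun u ↦ (u, w))
    omega
  have hc := card_erase_add_one hw
  have hd : 2 * k * #(S.erase w) ≤ #{e ∈ S.erase w ×ˢ S.erase w | G.Adj e.1 e.2} := by
    rw [← hc, mul_add] at h
    omega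
  have hne : (S.erase w).Nonempty := by
    by_contra hemp
    rw [not_nonempty_iff_eq_empty] at hemp
    have hS1 : S = {w} := by
      rw [← insert_erase hw, hemp, insert_empty_eq]
    subst hS1
    have : #{e ∈ ({w} : Finset V) ×ˢ {w} | G.Adj e.1 e.2} = 0 := by
      simp [Finset.filter_singleton]
    rw [this] at h
    simp at h
    omega
  obtain ⟨W, hW, h1, h2⟩ := ih _ (by omega) (S.erase w) hne hd rfl
  exact ⟨W, hW.trans (erase_subset _ _), h1, h2⟩

theorem SimpleGraph.exists_maximal_path {V : Type*} (G : SimpleGraph V) (W : Finset V)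
    (hW : W.Nonempty) :
    ∃ (L : ℕ) (f : ℕ → V), (∀ a ≤ L, f a ∈ W) ∧ Set.InjOn f (Set.Iic L) ∧
      (∀ a < L, G.Adj (f a) (f (a + 1))) ∧
      ∀ u ∈ W, G.Adj (f 0) u → ∃ a ≤ L, 1 ≤ a ∧ f a = u := by
  classical
  let P : ℕ → Prop := fun L ↦ ∃ f : ℕ → V, (∀ a ≤ L, f a ∈ W) ∧ Set.InjOn f (Set.Iic L) ∧
    ∀ a < L, G.Adj (f a) (f (a + 1))
  have hbound : ∀ L, P L → L ≤ W.card := by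
    rintro L ⟨f, h1, h2, -⟩
    have := Finset.card_le_card_of_injOn (s := Finset.range (L + 1)) (t := W) f
      (fun a ha ↦ h1 a (by simp at ha; omega))
      (h2.mono fun a ha ↦ by simp at ha ⊢; omega)
    simp at this
    omega
  have h0 : P 0 := by
    obtain ⟨w, hw⟩ := hW
    exact ⟨fun _ ↦ w, fun _ _ ↦ hw, by simp [Set.InjOn], by simp⟩
  obtain ⟨f, h1, h2, h3⟩ := Nat.findGreatest_spec (P := P) (Nat.zero_le W.card) h0
  set L := Nat.findGreatest P W.card with hL
  refine ⟨L, f, h1, h2, h3, fun u hu hadj ↦ ?_⟩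
  by_contra! hno
  have hu0 : ∀ a ≤ L, f a ≠ u := by
    intro a ha
    rcases Nat.eq_zero_or_pos a with rfl | hpos
    · exact G.ne_of_adj hadj
    · exact hno a ha hpos
  have hP : P (L + 1) := by
    refine ⟨fun a ↦ if a = 0 then u else f (a - 1), ?_, ?_, ?_⟩
    · intro a ha
      dsimp only
      split_ifs
      · exact hu
      · exact h1 _ (by omega)
    · intro a ha b hb hab
      simp only [Set.mem_Iic] at ha hb
      dsimp only at hab
      split_ifs at hab with ha0 hb0 hb0
      · omega
      · exact absurd hab.symm (hu0 _ (by omega))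
      · exact absurd hab (hu0 _ (by omega))
      · have := h2 (by simp; omega) (by simp; omega) hab
        omega
    · intro a ha
      rcases Nat.eq_zero_or_pos a with rfl | hpos
      · simpa using hadj.symm
      · have := h3 (a - 1) (by omega)
        rw [Nat.sub_add_cancel hpos] at this
        simpa [hpos.ne'] using this
  have := Nat.le_findGreatest (hbound _ hP) hP
  omega

theorem Finset.add_mul_le_max'_of_spaced (P : Finset ℕ) (s k : ℕ) (hk : k < P.card)
    (hne : P.Nonempty) (hpos : ∀ a ∈ P, 1 ≤ a)
    (hsp : ∀ a ∈ P, ∀ b ∈ P, a < b → s ≤ b - a) : 1 + k * s ≤ P.max' hne := by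
  rcases Nat.eq_zero_or_pos s with rfl | hs
  · simpa using hpos _ (P.max'_mem hne)
  have hc := Finset.card_le_card_of_injOn (s := P)
    (t := Finset.range ((P.max' hne - 1) / s + 1)) (fun a ↦ (a - 1) / s)
    (fun a ha ↦ by
      simp only [Finset.coe_range, Set.mem_Iio]
      exact Nat.lt_succ_of_le (Nat.div_le_div_right (Nat.sub_le_sub_right (P.le_max' a ha) 1)))
    (by
      have key : ∀ a ∈ P, ∀ b ∈ P, a < b → (a - 1) / s ≠ (b - 1) / s := by
        intro a ha b hb hab e
        have h1 := hsp a ha b hb hab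
        have h2 := hpos a ha
        have : (a - 1) / s + 1 ≤ (b - 1) / s := by
          rw [← Nat.add_div_right _ hs]
          exact Nat.div_le_div_right (by omega)
        omega
      intro a ha b hb e
      rcases lt_trichotomy a b with h | h | h
      · exact absurd e (key a ha b hb h)
      · exact h
      · exact absurd e.symm (key b hb a ha h))
  rw [Finset.card_range] at hc
  have h1 : k ≤ (P.max' hne - 1) / s := by omega
  have h2 := (Nat.le_div_iff_mul_le hs).1 h1
  have := hpos _ (P.max'_mem hne)
  omega

namespace SimpleGraph.IsLayering

variable {V : Type*} {G : SimpleGraph V} {d : V → ℕ} {p root : V → V}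

theorem level_iterate (hl : G.IsLayering d p root) {v : V} {l : ℕ} (h : l ≤ d v) :
    d (p^[l] v) + l = d v := by
  induction l with
  | zero => simp
  | succ l ih =>
    have h1 := ih (by omega)
    have h2 := (hl.parent (v := p^[l] v) (by omega)).2
    rw [Function.iterate_succ_apply']
    omega

theorem adj_iterate (hl : G.IsLayering d p root) {v : V} {l : ℕ} (h : l < d v) :
    G.Adj (p^[l] v) (p^[l + 1] v) := by
  have h1 := hl.level_iterate h.le
  rw [Function.iterate_succ_apply']
  exact (hl.parent (by omega)).1

theorem iterate_eq_root (hl : G.IsLayering d p root) (l : ℕ) {v : V} (h : d v = l) :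
    p^[l] v = root v := by
  induction l generalizing v with
  | zero => exact hl.eq_root h
  | succ l ih =>
    have h1 := hl.parent (v := v) (by omega)
    rw [Function.iterate_succ_apply, ih (by omega), hl.root_eq h1.1]

/-- A path between two vertices of level `i` whose branches in the layering meet exactly `h`
levels above closes up to a cycle, provided the path stays in levels at least `i`. -/
theorem exists_isCycle_of_path (hl : G.IsLayering d p root) {i h L : ℕ} {f : ℕ → V}
    (hL : 1 ≤ L) (hh : 1 ≤ h) (hhi : h ≤ i) (hinj : Set.InjOn f (Set.Iic L))
    (hadj : ∀ a < L, G.Adj (f a) (f (a + 1))) (hlev : ∀ a ≤ L, i ≤ d (f a))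
    (h0 : d (f 0) = i) (hL' : d (f L) = i) (hne : p^[h - 1] (f 0) ≠ p^[h - 1] (f L))
    (heq : p^[h] (f 0) = p^[h] (f L)) :
    ∃ (v : V) (c : G.Walk v v), c.IsCycle ∧ c.length = L + 2 * h := by
  set F : ℕ → V := fun a ↦ if a ≤ L then f a else if a ≤ L + h then p^[a - L] (f L)
    else p^[L + 2 * h - a] (f 0) with hF
  have F1 : ∀ a ≤ L, F a = f a := fun a ha ↦ by simp [hF, ha]
  have F2 : ∀ a, L ≤ a → a ≤ L + h → F a = p^[a - L] (f L) := by
    intro a h1 h2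
    rcases h1.eq_or_lt with rfl | h1
    · simp [hF]
    · simp [hF, h1.not_ge, h2]
  have F3 : ∀ a, L + h ≤ a → F a = p^[L + 2 * h - a] (f 0) := by
    intro a h1
    rcases h1.eq_or_lt with rfl | h1
    · rw [F2 _ (by omega) le_rfl, show L + h - L = h by omega,
        show L + 2 * h - (L + h) = h by omega, heq]
    · simp [hF, h1.not_ge, show ¬ a ≤ L by omega]
  have d2 : ∀ l ≤ h, d (p^[l] (f L)) + l = i := fun l hl' ↦ by
    rw [hl.level_iterate (by omega), hL']
  have d3 : ∀ l ≤ h, d (p^[l] (f 0)) + l = i := fun l hl' ↦ by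
    rw [hl.level_iterate (by omega), h0]
  have hne' : ∀ l < h, p^[l] (f L) ≠ p^[l] (f 0) := by
    intro l hlh e
    apply hne
    rw [show h - 1 = (h - 1 - l) + l by omega, Function.iterate_add_apply,
      Function.iterate_add_apply, e]
  rw [show L + 2 * h = L + 2 * h - 1 + 1 by omega]
  refine G.exists_isCycle_of_injOn (L + 2 * h - 1) F (by omega) ?_ ?_ ?_
  · have key : ∀ a b, a < b → b ≤ L + 2 * h - 1 → F a ≠ F b := by
      intro a b hab hb e
      rcases le_or_gt b L with h1 | h1
      · rw [F1 a (by omega), F1 b h1] at e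
        have := hinj (by simp; omega) (by simpa using h1) e
        omega
      rcases le_or_gt b (L + h) with h2 | h2
      · rw [F2 b h1.le h2] at e
        have e2 := d2 (b - L) (by omega)
        rw [← e] at e2
        rcases le_or_gt a L with h3 | h3
        · have := hlev a h3
          rw [F1 a h3] at e2
          omega
        · have := d2 (a - L) (by omega)
          rw [F2 a h3.le (by omega)] at e2
          omega
      · rw [F3 b h2.le] at e
        have e2 := d3 (L + 2 * h - b) (by omega)
        rw [← e] at e2
        rcases le_or_gt a L with h3 | h3
        · have := hlev a h3
          rw [F1 a h3] at e2
          omega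
        rcases le_or_gt a (L + h) with h4 | h4
        · have := d2 (a - L) (by omega)
          rw [F2 a h3.le h4] at e2 e
          have e3 : L + 2 * h - b = a - L := by omega
          rw [e3] at e
          exact hne' _ (by omega) e
        · have := d3 (L + 2 * h - a) (by omega)
          rw [F3 a h4.le] at e2
          omega
    intro a ha b hb e
    simp only [Set.mem_Iic] at ha hb
    rcases lt_trichotomy a b with h' | h' | h'
    · exact absurd e (key a b h' hb)
    · exact h'
    · exact absurd e.symm (key b a h' ha)
  · intro a ha
    rcases lt_or_ge a L with h1 | h1
    · rw [F1 a h1.le, F1 (a + 1) h1]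
      exact hadj a h1
    rcases lt_or_ge a (L + h) with h2 | h2
    · rw [F2 a h1 h2.le, F2 (a + 1) (by omega) h2, show a + 1 - L = a - L + 1 by omega]
      exact hl.adj_iterate (by omega)
    · rw [F3 a h2, F3 (a + 1) (by omega),
        show L + 2 * h - a = L + 2 * h - (a + 1) + 1 by omega]
      exact (hl.adj_iterate (by omega)).symm
  · rw [F3 _ (by omega), F1 0 (by omega), show L + 2 * h - (L + 2 * h - 1) = 0 + 1 by omega]
    exact (hl.adj_iterate (l := 0) (by omega)).symm

theorem exists_isCycle_of_chorded_cycle (hl : G.IsLayering d p root) {i : ℕ} {m ρ : ℤ} {c : ℤ → V}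
    (hc : ∀ a b, c a = c b ↔ 2 * m ∣ a - b) (hadj : ∀ a, G.Adj (c a) (c (a + 1)))
    (hchord : G.Adj (c 0) (c (2 * ρ + 1))) (hρ : 1 ≤ ρ) (hρm : ρ ≤ m - 2)
    (hlev : ∀ a, d (c (2 * a)) = i) (hlev' : ∀ a, i ≤ d (c a)) :
    ∃ h : ℕ, ∀ j : ℕ, 1 ≤ j → (j : ℤ) < m →
      ∃ (v : V) (w : G.Walk v v), w.IsCycle ∧ w.length = 2 * j + 2 * h := by
  classical
  have hroot : ∀ a, root (c a) = root (c 0) := by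
    intro a
    induction a using Int.induction_on with
    | zero => rfl
    | succ a ih => rw [← ih, hl.root_eq (hadj a)]
    | pred a ih =>
      rw [← ih]
      have := hl.root_eq (hadj (-a - 1))
      rwa [sub_add_cancel] at this
  have hex : ∃ h, ∀ a b, p^[h] (c (2 * a)) = p^[h] (c (2 * b)) := ⟨i, fun a b ↦ by
    rw [hl.iterate_eq_root i (hlev a), hl.iterate_eq_root i (hlev b), hroot, hroot (2 * b)]⟩
  have hspec := Nat.find_spec hex
  have hmin : ∀ h < Nat.find hex, _ := fun h ↦ Nat.find_min hex
  have hle : Nat.find hex ≤ i := Nat.find_min' hex fun a b ↦ by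
    rw [hl.iterate_eq_root i (hlev a), hl.iterate_eq_root i (hlev b), hroot, hroot (2 * b)]
  set h := Nat.find hex
  have hh : 1 ≤ h := by
    by_contra h0
    have h0 : h = 0 := by omega
    rw [h0] at hspec
    have := Int.le_of_dvd (by norm_num) ((hc _ _).1 (hspec 1 0))
    omega
  refine ⟨h, fun j hj hjm ↦ ?_⟩
  by_contra hno
  refine hmin (h - 1) (by omega) (const_of_forall_chordedPath
    (x := fun a ↦ p^[h - 1] (c (2 * a))) hj hjm hρ hρm ?_ ?_)
  · intro a
    have : c (2 * (a + m)) = c (2 * a) := (hc _ _).2 ⟨1, by ring⟩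
    simp only [this]
  · intro g hg a b ha hb
    by_contra hne
    refine hno (hl.exists_isCycle_of_path (f := fun t ↦ c (g t)) (i := i) (h := h) (L := 2 * j)
      (by omega) hh hle ?_ ?_ (fun t _ ↦ hlev' _) ?_ ?_ ?_ ?_)
    · intro s hs t ht e
      obtain ⟨lo, hlo⟩ := hg.window
      refine hg.inj s hs t ht ?_
      have h1 := hlo s hs
      have h2 := hlo t ht
      have h3 := Int.eq_zero_of_abs_lt_dvd ((hc _ _).1 e) (by rw [abs_lt]; constructor <;> omega)
      omega
    · intro t ht
      rcases hg.step t ht with e | e | ⟨e, e'⟩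
      · simp only [e]
        exact hadj _
      · have := hadj (g (t + 1))
        rw [e, sub_add_cancel] at this
        simp only [e]
        exact this.symm
      · simp only [e, e']
        exact hchord
    · simp only [ha]
      exact hlev a
    · simp only [hb]
      exact hlev b
    · simp only [ha, hb]
      exact hne
    · simp only [ha, hb]
      exact hspec a b

end SimpleGraph.IsLayering

theorem Int.emod_succ_cases {n : ℤ} (hn : 0 < n) (z : ℤ) :
    (z % n + 1 < n ∧ (z + 1) % n = z % n + 1) ∨ (z % n + 1 = n ∧ (z + 1) % n = 0) := by
  have h1 := Int.emod_lt_of_pos z hn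
  have h2 := Int.emod_nonneg z hn.ne'
  have h3 : (z + 1) % n = (z % n + 1) % n := by simp
  rcases (show z % n + 1 < n ∨ z % n + 1 = n by omega) with h | h
  · exact Or.inl ⟨h, by rw [h3, Int.emod_eq_of_lt (by omega) h]⟩
  · exact Or.inr ⟨h, by rw [h3, h, Int.emod_self]⟩

open Classical in
/-- A subgraph of two consecutive levels with minimum degree more than `k ≥ 2` contains a cycle
with a chord; it has length more than `2 * q * k` if all distances between chords of a path
starting at its endpoint are at least `2 * q`. -/
theorem SimpleGraph.exists_chorded_cycle {V : Type*} (G : SimpleGraph V) (d : V → ℕ)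
    (hd : ∀ {u v}, G.Adj u v → d u = d v + 1 ∨ d v = d u + 1) {i k q : ℕ} (hk : 2 ≤ k)
    (W : Finset V) (hW : W.Nonempty) (hWd : ∀ v ∈ W, d v = i ∨ d v = i + 1)
    (hdeg : ∀ w ∈ W, k < (W.filter fun u ↦ G.Adj w u).card)
    (hq : ∀ (v : V) (c : G.Walk v v), c.IsCycle → Even c.length → 2 * q + 2 ≤ c.length) :
    ∃ (m ρ : ℤ) (c : ℤ → V), (∀ a b, c a = c b ↔ 2 * m ∣ a - b) ∧
      (∀ a, G.Adj (c a) (c (a + 1))) ∧ G.Adj (c 0) (c (2 * ρ + 1)) ∧ 1 ≤ ρ ∧ ρ ≤ m - 2 ∧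
      (∀ a, d (c (2 * a)) = i) ∧ (∀ a, i ≤ d (c a)) ∧ (q * k + 1 : ℤ) ≤ m := by
  obtain ⟨L, f, hfW, hinj, hadj, hmax⟩ := G.exists_maximal_path W hW
  have hpar : ∀ a ≤ L, (a % 2 = 0 ↔ d (f a) = d (f 0)) := by
    intro a
    induction a with
    | zero => simp
    | succ a ih =>
      intro ha
      have h1 := ih (by omega)
      have h2 := hd (hadj a (by omega))
      have h3 := hWd _ (hfW a (by omega))
      have h4 := hWd _ (hfW (a + 1) ha)
      have h5 := hWd _ (hfW 0 (by omega))
      omega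
  set P : Finset ℕ := (Finset.Icc 1 L).filter fun a ↦ G.Adj (f 0) (f a) with hP
  have hPmem : ∀ a, a ∈ P ↔ (1 ≤ a ∧ a ≤ L) ∧ G.Adj (f 0) (f a) := fun a ↦ by simp [hP]
  have hPcard : k < P.card := by
    refine (hdeg _ (hfW 0 (by omega))).trans_le ?_
    refine (Finset.card_le_card (t := P.image f) ?_).trans Finset.card_image_le
    intro u hu
    rw [Finset.mem_filter] at hu
    obtain ⟨a, ha, ha1, rfl⟩ := hmax u hu.1 hu.2
    exact Finset.mem_image_of_mem _ ((hPmem a).2 ⟨⟨ha1, ha⟩, hu.2⟩)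
  have hPodd : ∀ a ∈ P, a % 2 = 1 := by
    intro a ha
    obtain ⟨⟨-, haL⟩, h⟩ := (hPmem a).1 ha
    have h1 := hpar a haL
    have h2 := hd h
    omega
  have hne : P.Nonempty := Finset.card_pos.1 (by omega)
  have hsp : ∀ a ∈ P, ∀ b ∈ P, a < b → 2 * q ≤ b - a := by
    intro a ha b hb hab
    have ho := hPodd a ha
    have ho' := hPodd b hb
    obtain ⟨⟨ha1, haL⟩, h⟩ := (hPmem a).1 ha
    obtain ⟨⟨hb1, hbL⟩, h'⟩ := (hPmem b).1 hb
    obtain ⟨v, c, hc, hlen⟩ := G.exists_isCycle_of_injOn (b - a + 1)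
      (fun t ↦ if t = 0 then f 0 else f (a + t - 1)) (by omega) (by
        intro s hs t ht e
        simp only [Set.mem_Iic] at hs ht
        dsimp only at e
        split_ifs at e with h1 h2 h2
        · omega
        · have := hinj (by simp) (by simp; omega) e
          omega
        · have := hinj (by simp; omega) (by simp) e
          omega
        · have := hinj (by simp; omega) (by simp; omega) e
          omega) (by
        intro t ht
        rcases Nat.eq_zero_or_pos t with rfl | h1
        · simpa using h
        · have := hadj (a + t - 1) (by omega)
          rw [Nat.sub_add_cancel (by omega)] at this
          simpa [h1.ne'] using this) (by
        have e : a + (b - a + 1) - 1 = b := by omega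
        simpa [e] using h'.symm)
    have := hq v c hc (by rw [hlen]; exact ⟨(b - a) / 2 + 1, by omega⟩)
    omega
  have hM := P.add_mul_le_max'_of_spaced (2 * q) k hPcard hne
    (fun a ha ↦ ((hPmem a).1 ha).1.1) hsp
  have hMmem := P.max'_mem hne
  have hMle := fun a ha ↦ P.le_max' a ha
  set M := P.max' hne
  obtain ⟨⟨-, hML⟩, hMadj⟩ := (hPmem M).1 hMmem
  have hModd := hPodd M hMmem
  obtain ⟨r, hr⟩ : ((P.erase M).erase 1).Nonempty := Finset.card_pos.1 (by
    have h1 := Finset.pred_card_le_card_erase (s := P.erase M) (a := 1)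
    have h2 := Finset.pred_card_le_card_erase (s := P) (a := M)
    omega)
  simp only [Finset.mem_erase] at hr
  obtain ⟨hr1, hrM, hrP⟩ := hr
  have hrle := hMle r hrP
  have hrodd := hPodd r hrP
  obtain ⟨⟨hr1', -⟩, hradj⟩ := (hPmem r).1 hrP
  have hn : (0 : ℤ) < M + 1 := by omega
  set c : ℤ → V := fun z ↦ f (z % (M + 1)).toNat with hcdef
  have hcbd : ∀ z : ℤ, 0 ≤ z % (M + 1) ∧ z % (M + 1) < M + 1 := fun z ↦
    ⟨Int.emod_nonneg z hn.ne', Int.emod_lt_of_pos z hn⟩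
  have hcnat : ∀ a : ℕ, a ≤ M → c a = f a := by
    intro a ha
    simp only [hcdef]
    rw [Int.emod_eq_of_lt (by omega) (by omega), Int.toNat_natCast]
  have hcinj : ∀ a b, c a = c b ↔ ((M : ℤ) + 1) ∣ a - b := by
    intro a b
    rw [Int.dvd_iff_emod_eq_zero, ← Int.emod_eq_emod_iff_emod_sub_eq_zero]
    have h1 := hcbd a
    have h2 := hcbd b
    constructor
    · intro e
      simp only [hcdef] at e
      have := hinj (by simp; omega) (by simp; omega) e
      omega
    · intro e
      simp only [hcdef]
      rw [e]
  have hcadj : ∀ a, G.Adj (c a) (c (a + 1)) := by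
    intro a
    have h1 := hcbd a
    simp only [hcdef]
    rcases Int.emod_succ_cases hn a with ⟨e1, e2⟩ | ⟨e1, e2⟩
    · rw [e2, Int.toNat_add h1.1 zero_le_one]
      exact hadj _ (by omega)
    · rw [e2, show a % ((M : ℤ) + 1) = M by omega]
      simpa using hMadj.symm
  have hcW : ∀ a, c a ∈ W := fun a ↦ hfW _ (by have := hcbd a; omega)
  obtain ⟨m, hm⟩ : ∃ m : ℕ, M + 1 = 2 * m := ⟨(M + 1) / 2, by omega⟩
  have hm' : (M : ℤ) + 1 = 2 * m := by exact_mod_cast hm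
  obtain ⟨ρ, hρ⟩ : ∃ ρ : ℕ, r = 2 * ρ + 1 := ⟨r / 2, by omega⟩
  have hρ' : (r : ℤ) = 2 * ρ + 1 := by exact_mod_cast hρ
  have hcpar : ∀ a, a % 2 = 0 ↔ d (c a) = d (f 0) := by
    intro a
    have h1 := hcbd a
    have h2 : a % ((M : ℤ) + 1) % 2 = a % 2 := Int.emod_emod_of_dvd a ⟨m, hm'⟩
    rw [← hpar _ (by omega)]
    omega
  have hi : ∀ a, i ≤ d (c a) := fun a ↦ by
    have := hWd _ (hcW a)
    omega
  have hqm : (q * k + 1 : ℤ) ≤ m := by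
    have : q * k + 1 ≤ m := by
      have : k * (2 * q) = 2 * (q * k) := by ring
      omega
    exact_mod_cast this
  have hc0 : c 0 = f 0 := by simpa using hcnat 0 (by omega)
  rcases hWd _ (hfW 0 (by omega)) with h0 | h0
  · refine ⟨m, ρ, c, ?_, hcadj, ?_, by omega, by omega, ?_, hi, hqm⟩
    · simpa only [hm'] using hcinj
    · rw [← hρ', hcnat r hrle, hc0]
      exact hradj
    · intro a
      rw [(hcpar _).1 (by omega), h0]
  · refine ⟨m, ρ, fun z ↦ c (r - z), ?_, ?_, ?_, by omega, by omega, ?_, fun a ↦ hi _, hqm⟩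
    · intro a b
      rw [hcinj, hm', show (r : ℤ) - a - (r - b) = -(a - b) by ring, dvd_neg]
    · intro a
      have := hcadj (r - (a + 1))
      rw [show (r : ℤ) - (a + 1) + 1 = r - a by ring] at this
      exact this.symm
    · simp only [← hρ', sub_zero, sub_self]
      rw [hcnat r hrle, hc0]
      exact hradj.symm
    · intro a
      have h1 := hcpar (r - 2 * a)
      have h2 := hWd _ (hcW (r - 2 * a))
      dsimp only
      omega

/-- Let `k ≥ 2` and let `G` be a graph of average degree at least
`8k` containing an even cycle, with even girth `g` (the length of a shortest even
cycle). Then `G` contains cycles of `(g/2 − 1)·k` consecutive even lengths. -/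
theorem even_girth_consecutive_even_cycles
    {V : Type*} [Fintype V] [Nonempty V] (G : SimpleGraph V) (k g : ℕ)
    (hk : 2 ≤ k)
    (havg : 8 * k * Fintype.card V ≤ 2 * G.edgeSet.ncard)
    (hgmem : ∃ (v : V) (c : G.Walk v v), c.IsCycle ∧ Even c.length ∧ c.length = g)
    (hgmin : ∀ (v : V) (c : G.Walk v v), c.IsCycle → Even c.length → g ≤ c.length) :
    ∃ t : ℕ, Even t ∧
      ∀ i : ℕ, i < (g / 2 - 1) * k →
        ∃ (v : V) (c : G.Walk v v), c.IsCycle ∧ c.length = t + 2 * i := by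
  classical
  obtain ⟨χ, hχ⟩ := G.exists_cut
  let B : SimpleGraph V :=
    { Adj := fun u v ↦ G.Adj u v ∧ χ u ≠ χ v
      symm := ⟨fun u v h ↦ ⟨h.1.symm, h.2.symm⟩⟩
      loopless := ⟨fun u h ↦ h.2 rfl⟩ }
  have hBG : B ≤ G := fun u v h ↦ h.1
  obtain ⟨d, p, root, hl⟩ := B.exists_isLayering χ fun u v h ↦ h.2
  obtain ⟨i, S, hS, hSd, hSdense⟩ := B.exists_dense_levels d hl.level k (by
    refine le_trans ?_ (hχ.trans_eq (by congr))
    nlinarith)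
  obtain ⟨W, hWS, hW, hdeg⟩ := B.exists_lt_degree_of_dense k (by omega) S hS hSdense
  obtain ⟨m, ρ, c, hc, hadj, hchord, hρ, hρm, hlev, hlev', hm⟩ :=
    B.exists_chorded_cycle d hl.level (q := g / 2 - 1) hk W hW (fun v hv ↦ hSd v (hWS hv)) hdeg
      (fun v w hw he ↦ by
        have h1 := hgmin v (w.mapLe hBG) (hw.mapLe hBG) (by simpa using he)
        have h2 := hw.three_le_length
        obtain ⟨s, hs⟩ := he
        simp only [SimpleGraph.Walk.length_mapLe] at h1
        omega)
  obtain ⟨h, hcyc⟩ := hl.exists_isCycle_of_chorded_cycle hc hadj hchord hρ hρm hlev hlev'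
  refine ⟨2 * h + 2, ⟨h + 1, by ring⟩, fun j hj ↦ ?_⟩
  obtain ⟨v, w, hw, hlen⟩ := hcyc (j + 1) (by omega) (by
    have : (j : ℤ) < (g / 2 - 1 : ℕ) * k := by exact_mod_cast hj
    push_cast
    omega)
  exact ⟨v, w.mapLe hBG, hw.mapLe hBG, by rw [SimpleGraph.Walk.length_mapLe, hlen]; ring⟩
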